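/- arXiv:math/0608245 — 2 statements merged into one kernel-verified Lean document; each statement's English description precedes it below -/
import Mathlib

section
/- Let r, k, n be integers with n ≥ r+1 and r+1 ≥ k ≥ 4, and let H be a simple graph on k vertices which does not contain a cycle on 4 vertices. Then σ(K_{r+1} − H, n) ≥ (r−1)(2n−r) − 3(n−r) − 1 if n−r is odd, and σ(K_{r+1} − H, n) ≥ (r−1)(2n−r) − 3(n−r) − 2 if n−r is even. -/
open SimpleGraph Finset
open scoped Classical

/-- `G` contains a copy of `H` as a subgraph. -/
def ContainsCopy {α β : Type*} (G : SimpleGraph α) (H : SimpleGraph β) : Prop :=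
  ∃ f : β ↪ α, ∀ u v, H.Adj u v → G.Adj (f u) (f v)

/-- `G` is a realization of the degree sequence `d` (vertex `i` has degree `d i`). -/
def IsRealization {n : ℕ} (G : SimpleGraph (Fin n)) (d : Fin n → ℕ) : Prop :=
  ∀ i, G.degree i = d i

/-- `d` is a graphic sequence: it is nonincreasing and is the degree sequence of a
simple graph on `n` vertices. -/
def IsGraphic {n : ℕ} (d : Fin n → ℕ) : Prop :=
  Antitone d ∧ ∃ G : SimpleGraph (Fin n), IsRealization G d

/-- `d` is potentially `H`-graphic: some realization of `d` contains a copy of `H`. -/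
def PotentiallyGraphic {n : ℕ} (d : Fin n → ℕ) {β : Type*} (H : SimpleGraph β) : Prop :=
  ∃ G : SimpleGraph (Fin n), IsRealization G d ∧ ContainsCopy G H

/-- The set of even integers `l` such that every `n`-term graphic sequence with degree sum
at least `l` is potentially `H`-graphic; `σ(H, n)` is the least element of this set. -/
def SigmaSet {β : Type*} (H : SimpleGraph β) (n : ℕ) : Set ℕ :=
  {l | Even l ∧ ∀ d : Fin n → ℕ, IsGraphic d → l ≤ ∑ i, d i → PotentiallyGraphic d H}

/-- `K_m - H`: the complete graph on `m` vertices minus the edge set of a copy of `H`. -/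
def KsubH (m k : ℕ) (h : k ≤ m) (H : SimpleGraph (Fin k)) : SimpleGraph (Fin m) :=
  (⊤ : SimpleGraph (Fin m)) \ H.map (Fin.castLEEmb h)

/-- `Z₄ = K₄ - P₂`: the complete graph on 4 vertices minus two adjacent edges. -/
def Z4 : SimpleGraph (Fin 4) :=
  (⊤ : SimpleGraph (Fin 4)) \ SimpleGraph.fromEdgeSet {s(0, 1), s(1, 2)}

/-- The cycle on 4 vertices. -/
def C4 : SimpleGraph (Fin 4) :=
  SimpleGraph.fromEdgeSet {s(0, 1), s(1, 2), s(2, 3), s(3, 0)}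

/-- 1-indexed access `d_i` to a finite sequence (0 outside the range). -/
def nth {n : ℕ} (d : Fin n → ℕ) (i : ℕ) : ℕ :=
  if h : i - 1 < n then d ⟨i - 1, h⟩ else 0

/-- The join of a complete graph on the vertices `< s` with a maximum matching on the others. -/
def joinMatching (s n : ℕ) : SimpleGraph (Fin n) where
  Adj i j := i ≠ j ∧ (i.val < s ∨ j.val < s ∨ (i.val - s) / 2 = (j.val - s) / 2)
  symm := ⟨fun i j h => ⟨h.1.symm, by rcases h.2 with h | h | h <;> simp [h]⟩⟩
  loopless := ⟨fun i h => h.1 rfl⟩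

lemma joinMatching_adj {s n : ℕ} {i j : Fin n} : (joinMatching s n).Adj i j ↔
    i ≠ j ∧ (i.val < s ∨ j.val < s ∨ (i.val - s) / 2 = (j.val - s) / 2) :=
  Iff.rfl

/-- The degree of the `i`-th vertex of `joinMatching s n`. -/
def joinMatchingDegree (s n i : ℕ) : ℕ :=
  if i < s then n - 1 else if i + 1 = n ∧ Odd (n - s) then s else s + 1

lemma card_filter_val_lt {s n : ℕ} (h : s ≤ n) :
    #{j : Fin n | j.val < s} = s := by
  simp [Fin.card_filter_val_lt, h]

lemma degree_joinMatching {s n : ℕ} (h : s ≤ n) (i : Fin n) :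
    (joinMatching s n).degree i = joinMatchingDegree s n i := by
  rw [← card_neighborFinset_eq_degree]
  unfold joinMatchingDegree
  split_ifs with h₁ h₂
  · have : (joinMatching s n).neighborFinset i = univ.erase i := by
      ext j
      simp [joinMatching_adj, h₁, eq_comm]
    rw [this, card_erase_of_mem (mem_univ i)]
    simp
  · have : (joinMatching s n).neighborFinset i =
        ({j : Fin n | j.val < s} : Finset (Fin n)) := by
      ext j
      obtain ⟨t, ht⟩ := h₂.2
      simp only [joinMatching_adj, mem_neighborFinset, mem_filter, mem_univ, true_and, ne_eq,
        Fin.ext_iff]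
      omega
    rw [this, card_filter_val_lt h]
  · obtain ⟨p, hp⟩ : ∃ p : Fin n, s ≤ p.val ∧ p ≠ i ∧ (i.val - s) / 2 = (p.val - s) / 2 := by
      rw [not_and, Nat.not_odd_iff_even] at h₂
      rcases Nat.even_or_odd' (i.val - s) with ⟨t, ht | ht⟩
      · have : i.val + 1 < n := by
          by_contra hlt
          obtain ⟨u, hu⟩ := h₂ (by omega)
          omega
        exact ⟨⟨i + 1, this⟩, by simp only [ne_eq, Fin.ext_iff]; omega⟩
      · exact ⟨⟨i - 1, by omega⟩, by simp only [ne_eq, Fin.ext_iff]; omega⟩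
    have : (joinMatching s n).neighborFinset i =
        insert p ({j : Fin n | j.val < s} : Finset (Fin n)) := by
      ext j
      simp only [joinMatching_adj, mem_neighborFinset, mem_filter, mem_univ, true_and, ne_eq,
        Fin.ext_iff, mem_insert] at hp ⊢
      omega
    rw [this, card_insert_of_notMem (by simp [hp.1]), card_filter_val_lt h]

lemma antitone_joinMatchingDegree {s n : ℕ} (h : s + 2 ≤ n) :
    Antitone fun i : Fin n => joinMatchingDegree s n i := by
  intro i j hij
  have hij : i.val ≤ j.val := hij
  have hj := j.isLt
  simp only [joinMatchingDegree]
  grind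

lemma sum_joinMatchingDegree {s n : ℕ} (h : s < n) :
    (∑ i : Fin n, joinMatchingDegree s n i) + (if Odd (n - s) then 1 else 0) =
      s * (n - 1) + (n - s) * (s + 1) := by
  obtain ⟨u, rfl⟩ := Nat.exists_eq_add_of_lt h
  rw [Fin.sum_univ_eq_sum_range (joinMatchingDegree s (s + u + 1)), sum_range_succ,
    sum_range_add]
  have h₁ : ∑ x ∈ range s, joinMatchingDegree s (s + u + 1) x = s * (s + u) := by
    rw [sum_const_nat (m := s + u) (by intro x hx; simp_all [joinMatchingDegree])]
    simp
  have h₂ : ∑ x ∈ range u, joinMatchingDegree s (s + u + 1) (s + x) = u * (s + 1) := by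
    rw [sum_const_nat (m := s + 1)
      (by intro x hx; have := (mem_range.1 hx).ne; simp [joinMatchingDegree, this])]
    simp
  have h₃ : s + u + 1 - s = u + 1 := by omega
  rw [h₁, h₂, h₃, Nat.add_sub_cancel]
  simp only [joinMatchingDegree, h₃, true_and]
  split_ifs <;> first | omega | ring

section Realization

variable {s n : ℕ} {G : SimpleGraph (Fin n)}

lemma adj_of_isRealization (hG : IsRealization G fun i => joinMatchingDegree s n i)
    {i j : Fin n} (hi : i.val < s) (hij : i ≠ j) : G.Adj i j := by
  have hd : G.degree i = n - 1 := by rw [hG i]; simp [joinMatchingDegree, hi]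
  have hsub : G.neighborFinset i ⊆ univ.erase i := fun x hx => by
    simpa using ((mem_neighborFinset _ _ _).1 hx).ne'
  have heq := eq_of_subset_of_card_le hsub
    (by rw [card_neighborFinset_eq_degree, hd]; simp [card_erase_of_mem])
  rw [← mem_neighborFinset, heq]
  simpa using hij.symm

lemma eq_of_adj_of_isRealization (h : s ≤ n)
    (hG : IsRealization G fun i => joinMatchingDegree s n i)
    {i j l : Fin n} (hi : s ≤ i.val) (hj : s ≤ j.val) (hl : s ≤ l.val)
    (hij : G.Adj i j) (hil : G.Adj i l) : j = l := by
  by_contra hjl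
  have hd : G.degree i ≤ s + 1 := by
    rw [hG i]
    simp only [joinMatchingDegree]
    split_ifs <;> omega
  have hsub : insert j (insert l ({x : Fin n | x.val < s} : Finset (Fin n))) ⊆
      G.neighborFinset i := by
    intro x hx
    rw [mem_neighborFinset]
    simp only [mem_insert, mem_filter, mem_univ, true_and] at hx
    rcases hx with rfl | rfl | hx
    · exact hij
    · exact hil
    · exact (adj_of_isRealization hG hx (by rintro rfl; omega)).symm
  have hcard := card_le_card hsub
  rw [card_insert_of_notMem (by simp [hjl, hj]), card_insert_of_notMem (by simp [hl]),
    card_filter_val_lt h, card_neighborFinset_eq_degree] at hcard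
  omega

end Realization

lemma containsCopy_C4 {α : Type*} {H : SimpleGraph α} {a b c d : α}
    (hab : H.Adj a b) (hbc : H.Adj b c) (hcd : H.Adj c d) (hda : H.Adj d a)
    (hac : a ≠ c) (hbd : b ≠ d) : ContainsCopy H C4 := by
  refine ⟨⟨![a, b, c, d], ?_⟩, ?_⟩
  · have := hab.ne
    have := hbc.ne
    have := hcd.ne
    have := hda.ne
    intro x y
    fin_cases x <;> fin_cases y <;> simp_all [eq_comm]
  · intro x y
    change C4.Adj x y → H.Adj (![a, b, c, d] x) (![a, b, c, d] y)
    fin_cases x <;> fin_cases y <;>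
      simp [C4, hab, hbc, hcd, hda, hab.symm, hbc.symm, hcd.symm, hda.symm]

/-- The complement of a graph of maximum degree at most one on at least four vertices
contains a cycle on four vertices. -/
lemma containsCopy_C4_of_degree_le_one {α : Type*} {H : SimpleGraph α} {R : α → α → Prop}
    (hR : ∀ x y, R x y → R y x) {S : Finset α} (hS : 4 ≤ #S)
    (huniq : ∀ x ∈ S, ∀ y ∈ S, ∀ z ∈ S, R x y → R x z → y = z)
    (hadj : ∀ x ∈ S, ∀ y ∈ S, x ≠ y → ¬ R x y → H.Adj x y) : ContainsCopy H C4 := by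
  obtain ⟨T, hTS, hT⟩ := exists_subset_card_eq hS
  obtain ⟨a, b, c, d, hab, hac, had, hbc, hbd, hcd, rfl⟩ := card_eq_four.1 hT
  simp only [insert_subset_iff, singleton_subset_iff] at hTS
  obtain ⟨ha, hb, hc, hd⟩ := hTS
  by_cases h₁ : R a b ∨ R c d
  · refine containsCopy_C4 (a := a) (b := c) (c := b) (d := d) (hadj _ ha _ hc hac ?_)
      (hadj _ hc _ hb hbc.symm ?_) (hadj _ hb _ hd hbd ?_) (hadj _ hd _ ha had.symm ?_) hab hcd <;>
    grind
  by_cases h₂ : R a c ∨ R b d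
  · refine containsCopy_C4 (a := a) (b := b) (c := c) (d := d) (hadj _ ha _ hb hab ?_)
      (hadj _ hb _ hc hbc ?_) (hadj _ hc _ hd hcd ?_) (hadj _ hd _ ha had.symm ?_) hac hbd <;>
    grind
  refine containsCopy_C4 (a := a) (b := b) (c := d) (d := c) (hadj _ ha _ hb hab ?_)
    (hadj _ hb _ hd hbd ?_) (hadj _ hd _ hc hcd.symm ?_) (hadj _ hc _ ha hac.symm ?_) had hbc <;>
  grind

lemma containsCopy_C4_of_map {α β : Type*} {H : SimpleGraph α} (e : α ↪ β)
    (h : ContainsCopy (H.map e) C4) : ContainsCopy H C4 := by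
  obtain ⟨f, hf⟩ := h
  have key : ∀ u v, C4.Adj u v → ∃ x y, H.Adj x y ∧ e x = f u ∧ e y = f v := fun u v huv => by
    simpa [SimpleGraph.map_adj] using hf u v huv
  have hnext : ∀ u, ∃ v, C4.Adj u v := fun u => ⟨u + 1, by fin_cases u <;> simp [C4]⟩
  have hpre : ∀ u, ∃ x, e x = f u := fun u => by
    obtain ⟨v, hv⟩ := hnext u
    obtain ⟨x, _, _, hx, _⟩ := key u v hv
    exact ⟨x, hx⟩
  choose g hg using hpre
  refine ⟨⟨g, fun u v huv => f.injective (by rw [← hg, ← hg, huv])⟩, fun u v huv => ?_⟩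
  obtain ⟨x, y, hxy, hx, hy⟩ := key u v huv
  rw [← hg] at hx hy
  rwa [e.injective hx, e.injective hy] at hxy

lemma not_potentiallyGraphic_joinMatchingDegree {s k n : ℕ} (h : s ≤ n) (hk : k ≤ s + 4)
    {H : SimpleGraph (Fin k)} (hC4 : ¬ ContainsCopy H C4) :
    ¬ PotentiallyGraphic (fun i : Fin n => joinMatchingDegree s n i) (KsubH (s + 4) k hk H) := by
  rintro ⟨G, hG, f, hf⟩
  refine hC4 (containsCopy_C4_of_map (Fin.castLEEmb hk) ?_)
  have hS : 4 ≤ #{x | s ≤ (f x).val} := by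
    have hsmall : #{x | (f x).val < s} ≤ s := by
      refine (card_le_card_of_injOn f (fun x hx => ?_) f.injective.injOn).trans_eq
        (card_filter_val_lt h)
      simpa using hx
    have := card_filter_add_card_filter_not (s := univ) (fun x => (f x).val < s)
    simp only [not_lt, card_univ, Fintype.card_fin] at this
    omega
  refine containsCopy_C4_of_degree_le_one (R := fun x y => G.Adj (f x) (f y))
    (fun x y hxy => hxy.symm) hS (fun x hx y hy z hz hxy hxz => ?_) (fun x _ y _ hne hxy => ?_)
  · simp only [mem_filter, mem_univ, true_and] at hx hy hz
    exact f.injective (eq_of_adj_of_isRealization h hG hx hy hz hxy hxz)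
  · by_contra hH
    exact hxy (hf x y (by rw [KsubH, sdiff_adj]; exact ⟨hne, hH⟩))

/-- Lemma 3.7: for `n ≥ r + 1`, `r + 1 ≥ k ≥ 4` and `H` a graph on `k` vertices not
containing a cycle on 4 vertices, `σ(K_{r+1} - H, n) ≥ (r-1)(2n-r) - 3(n-r) - 1` if
`n - r` is odd, and `σ(K_{r+1} - H, n) ≥ (r-1)(2n-r) - 3(n-r) - 2` if `n - r` is even. -/
theorem stmt11 (r k n : ℕ) (hn : r + 1 ≤ n) (hk4 : 4 ≤ k) (hkr : k ≤ r + 1)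
    (H : SimpleGraph (Fin k)) (hC4 : ¬ ContainsCopy H C4) (m : ℕ)
    (hm : IsLeast (SigmaSet (KsubH (r + 1) k hkr H) n) m) :
    (if Odd (n - r)
      then ((r : ℤ) - 1) * (2 * (n : ℤ) - r) - 3 * ((n : ℤ) - r) - 1
      else ((r : ℤ) - 1) * (2 * (n : ℤ) - r) - 3 * ((n : ℤ) - r) - 2) ≤ (m : ℤ) := by
  obtain ⟨s, rfl⟩ : ∃ s, r = s + 3 := ⟨r - 3, by omega⟩
  obtain ⟨t, rfl⟩ : ∃ t, n = s + 4 + t := ⟨n - (s + 4), by omega⟩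
  have hreal : IsRealization (joinMatching s (s + 4 + t))
      fun i => joinMatchingDegree s (s + 4 + t) i := degree_joinMatching (by omega)
  have hlt : ∑ i : Fin (s + 4 + t), joinMatchingDegree s (s + 4 + t) i < m := by
    by_contra hle
    exact not_potentiallyGraphic_joinMatchingDegree (by omega) hkr hC4
      (hm.1.2 _ ⟨antitone_joinMatchingDegree (by omega), _, hreal⟩ (not_lt.1 hle))
  have heven : Even (∑ i : Fin (s + 4 + t), joinMatchingDegree s (s + 4 + t) i) := by
    rw [← sum_congr rfl fun i _ => hreal i, sum_degrees_eq_twice_card_edges]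
    exact even_two_mul _
  have hsum := sum_joinMatchingDegree (s := s) (n := s + 4 + t) (by omega)
  obtain ⟨a, ha⟩ := heven
  obtain ⟨b, hb⟩ := hm.1.1
  have hle : (∑ i : Fin (s + 4 + t), joinMatchingDegree s (s + 4 + t) i) + 2 ≤ m := by omega
  have hpar : Odd (s + 4 + t - s) ↔ ¬ Odd (s + 4 + t - (s + 3)) := by
    rw [show s + 4 + t - s = t + 1 + 3 by omega, show s + 4 + t - (s + 3) = t + 1 by omega]
    grind
  rw [show s + 4 + t - 1 = s + 3 + t by omega] at hsum
  simp only [hpar] at hsum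
  rw [show s + 4 + t - s = t + 4 by omega] at hsum
  zify at hsum hle
  split_ifs at hsum ⊢ with hodd <;> push_cast at hsum ⊢ <;> grind
end

section
/- Let π = (d_1, ..., d_n) be a graphic sequence and let G be a realization of π on vertices v_1, ..., v_n with d_G(v_i) = d_i for each i. If the subgraph of G induced by {v_1, ..., v_{r+1}} has at most ε(K_{r+1}) − 1 edges (i.e., at most r(r+1)/2 − 1 edges), then there is a realization H of π on the same vertex set such that d_H(v_i) = d_i for i = 1, 2, ..., r+1 and v_r v_{r+1} is not an edge of H. -/
open SimpleGraph Finset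
open scoped Classical

/-- The graph obtained from `G` by replacing the edges `ac`, `bx` with `ab`, `cx`. -/
def switchEdges {V : Type*} (G : SimpleGraph V) (a b c x : V) : SimpleGraph V :=
  (G \ SimpleGraph.fromEdgeSet {s(a, c), s(b, x)}) ⊔ SimpleGraph.fromEdgeSet {s(a, b), s(c, x)}

theorem degree_switchEdges {V : Type*} [Fintype V] (G : SimpleGraph V) {a b c x : V}
    (hac : G.Adj a c) (hbx : G.Adj b x) (hab : ¬ G.Adj a b) (hcx : ¬ G.Adj c x)
    (hne : a ≠ b) (hne' : c ≠ x) (v : V) :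
    (switchEdges G a b c x).degree v = G.degree v := by
  have key : ∀ y z : V, G.Adj v y → ¬ G.Adj v z →
      (∀ w, (switchEdges G a b c x).Adj v w ↔ w = z ∨ (w ≠ y ∧ G.Adj v w)) →
      (switchEdges G a b c x).degree v = G.degree v := by
    intro y z hy hz h
    have hN : (switchEdges G a b c x).neighborFinset v =
        insert z ((G.neighborFinset v).erase y) := by
      ext w
      simp [h w]
    rw [← card_neighborFinset_eq_degree, hN, Finset.card_insert_of_notMem (by simp [hz]),
      Finset.card_erase_add_one (by simpa using hy), card_neighborFinset_eq_degree]
  have hac' := hac.ne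
  have hbx' := hbx.ne
  have hax : a ≠ x := by rintro rfl; exact hab hbx.symm
  have hbc : b ≠ c := by rintro rfl; exact hab hac
  have hadj : ∀ w, (switchEdges G a b c x).Adj v w ↔
      (G.Adj v w ∧ ¬ (v = a ∧ w = c ∨ v = c ∧ w = a ∨ v = b ∧ w = x ∨ v = x ∧ w = b)) ∨
      (v = a ∧ w = b ∨ v = b ∧ w = a ∨ v = c ∧ w = x ∨ v = x ∧ w = c) := by
    intro w
    have := fun h : G.Adj v w => h.ne
    simp only [switchEdges, sup_adj, sdiff_adj, fromEdgeSet_adj, Set.mem_insert_iff,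
      Set.mem_singleton_iff, Sym2.eq_iff]
    grind
  by_cases ha : v = a
  · subst ha
    exact key c b hac hab (by grind)
  by_cases hb : v = b
  · subst hb
    exact key x a hbx (fun h => hab h.symm) (by grind)
  by_cases hc : v = c
  · subst hc
    exact key a x hac.symm hcx (by grind)
  by_cases hx : v = x
  · subst hx
    exact key b c hbx.symm (fun h => hcx h.symm) (by grind)
  have hN : (switchEdges G a b c x).neighborFinset v = G.neighborFinset v := by
    ext w
    simp [hadj, ha, hb, hc, hx]
  rw [← card_neighborFinset_eq_degree, hN, card_neighborFinset_eq_degree]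

/-- A non-edge `ab` can be moved to `ac`, preserving all degrees, whenever the degree of `c` is at
most that of `b`. -/
theorem exists_not_adj_of_degree_le {V : Type*} [Fintype V] (G : SimpleGraph V) {a b c : V}
    (hab : ¬ G.Adj a b) (hne : a ≠ b) (hdeg : G.degree c ≤ G.degree b) :
    ∃ H : SimpleGraph V, (∀ v, H.degree v = G.degree v) ∧ ¬ H.Adj a c := by
  by_cases hac : G.Adj a c
  swap
  · exact ⟨G, fun _ => rfl, hac⟩
  have hbc : b ≠ c := by rintro rfl; exact hab hac
  obtain ⟨x, hbx, hcx, hxc⟩ : ∃ x, G.Adj b x ∧ ¬ G.Adj c x ∧ c ≠ x := by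
    by_contra! hcon
    have hlt : ((G.neighborFinset b).erase c).card < ((G.neighborFinset c).erase b).card := by
      refine Finset.card_lt_card ((Finset.ssubset_iff_of_subset ?_).2 ⟨a, ?_, ?_⟩)
      · intro x hx
        simp only [Finset.mem_erase, mem_neighborFinset] at hx ⊢
        exact ⟨hx.2.ne', by_contra fun h => hx.1 (hcon x hx.2 h).symm⟩
      · simpa using ⟨hne, hac.symm⟩
      · simp only [Finset.mem_erase, mem_neighborFinset, not_and]
        exact fun _ h => hab h.symm
    rw [Finset.card_erase_eq_ite, Finset.card_erase_eq_ite] at hlt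
    simp only [mem_neighborFinset, card_neighborFinset_eq_degree, G.adj_comm c b] at hlt
    split_ifs at hlt <;> omega
  refine ⟨switchEdges G a b c x, degree_switchEdges G hac hbx hab hcx hne hxc, ?_⟩
  have hax : a ≠ x := by rintro rfl; exact hab hbx.symm
  simp [switchEdges, hac.ne, hbc.symm, hax, hne]

/-- A graph with fewer than `r(r+1)/2` edges among its first `r+1` vertices has a non-edge there. -/
theorem exists_not_adj_of_ncard_le {n r : ℕ} (hr : 1 ≤ r) (hrn : r + 1 ≤ n)
    (G : SimpleGraph (Fin n))
    (hE : ((G.induce {v : Fin n | (v : ℕ) < r + 1}).edgeSet).ncard ≤ r * (r + 1) / 2 - 1) :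
    ∃ i j : Fin n, i < j ∧ (j : ℕ) ≤ r ∧ ¬ G.Adj i j := by
  by_contra! hcon
  have htop : G.induce {v : Fin n | (v : ℕ) < r + 1} = ⊤ := by
    ext ⟨u, hu⟩ ⟨v, hv⟩
    simp only [Set.mem_ofPred_eq] at hu hv
    simp only [comap_adj, Function.Embedding.subtype_apply, top_adj, ne_eq, Subtype.mk.injEq]
    refine ⟨fun h => h.ne, fun h => ?_⟩
    rcases lt_or_gt_of_ne h with h | h
    · exact hcon u v h (by omega)
    · exact (hcon v u h (by omega)).symm
  have hcard : Fintype.card {v : Fin n | (v : ℕ) < r + 1} = r + 1 :=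
    (Fintype.card_congr (Fin.castLEquiv hrn).symm).trans (Fintype.card_fin _)
  rw [htop, ← coe_edgeFinset, Set.ncard_coe_finset, card_edgeFinset_top_eq_card_choose_two,
    hcard, Nat.choose_two_right, Nat.add_sub_cancel, mul_comm (r + 1) r] at hE
  have : 2 ≤ r * (r + 1) := by nlinarith
  omega

/-- Lemma 2.3: let `π = (d₁, ..., dₙ)` be a graphic sequence and `G` a realization of
`π` with `d_G(v_i) = d_i` for each `i`. If the subgraph of `G` induced by
`{v₁, ..., v_{r+1}}` has at most `ε(K_{r+1}) - 1 = r(r+1)/2 - 1` edges, then there is a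
realization `H` of `π` (on the same vertex set) with `d_H(v_i) = d_i` for
`i = 1, ..., r+1` and `v_r v_{r+1} ∉ E(H)`. -/
theorem stmt12 (n r : ℕ) (hr : 1 ≤ r) (hrn : r + 1 ≤ n)
    (d : Fin n → ℕ) (hd : Antitone d)
    (G : SimpleGraph (Fin n)) (hG : IsRealization G d)
    (hE : ((G.induce {v : Fin n | (v : ℕ) < r + 1}).edgeSet).ncard ≤ r * (r + 1) / 2 - 1) :
    ∃ H : SimpleGraph (Fin n), ∃ σ : Equiv.Perm (Fin n),
      (∀ i, H.degree (σ i) = d i) ∧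
      (∀ i : Fin n, (i : ℕ) < r + 1 → σ i = i) ∧
      ¬ H.Adj ⟨r - 1, by omega⟩ ⟨r, by omega⟩ := by
  obtain ⟨i, j, hij, hj, hadj⟩ := exists_not_adj_of_ncard_le hr hrn G hE
  have hij' : (i : ℕ) < j := hij
  obtain ⟨H₁, hH₁, hadj₁⟩ := exists_not_adj_of_degree_le G (c := ⟨r, by omega⟩) hadj hij.ne
    (by rw [hG, hG]; exact hd (Fin.le_def.2 hj))
  obtain ⟨H₂, hH₂, hadj₂⟩ := exists_not_adj_of_degree_le H₁ (a := ⟨r, by omega⟩) (b := i)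
    (c := ⟨r - 1, by omega⟩) (fun h => hadj₁ h.symm) (Fin.ne_of_val_ne (by dsimp only; omega))
    (by rw [hH₁, hH₁, hG, hG]; exact hd (Fin.le_def.2 (by dsimp only; omega)))
  exact ⟨H₂, Equiv.refl _, fun k => (hH₂ k).trans ((hH₁ k).trans (hG k)), fun _ _ => rfl,
    fun h => hadj₂ h.symm⟩
end
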